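/- Let V be a 7-dimensional real vector space, B a nondegenerate symmetric bilinear form on V, and × a cross product on (V, B). Then the bilinear form B can be recovered from the cross product via the trace formula B(x, y) = −(1/6)·tr(v ↦ x × (y × v)) for all x, y ∈ V. -/

import Mathlib

section CrossProduct

variable {V : Type*} [AddCommGroup V] [Module ℝ V]
  {B : V →ₗ[ℝ] V →ₗ[ℝ] ℝ} {cross : V →ₗ[ℝ] V →ₗ[ℝ] V}

/-- Left multiplication by a vector is skew-adjoint. -/
lemma cross_skewAdjoint (hskew : ∀ x y, cross x y = - cross y x)
    (horth : ∀ x y, B (cross x y) x = 0) (x v w : V) :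
    B (cross x v) w = - B (cross x w) v := by
  have h := horth (v + w) x
  have hv := horth v x
  have hw := horth w x
  simp only [map_add, LinearMap.add_apply] at h
  rw [hskew x v, hskew x w]
  simp only [map_neg, LinearMap.neg_apply]
  linarith

/-- The composition law, polarized in its second argument. -/
lemma cross_form_polarized (hsymm : ∀ x y, B x y = B y x)
    (hcomp : ∀ x y, B (cross x y) (cross x y) = B x x * B y y - (B x y) ^ 2) (x v w : V) :
    B (cross x v) (cross x w) = B x x * B v w - B x v * B x w := by
  have h := hcomp x (v + w)
  have hv := hcomp x v
  have hw := hcomp x w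
  simp only [map_add, LinearMap.add_apply] at h
  rw [hsymm (cross x w) (cross x v), hsymm w v] at h
  linear_combination (h - hv - hw) / 2

lemma cross_cross_self (hsymm : ∀ x y, B x y = B y x)
    (hnd : ∀ x, (∀ y, B x y = 0) → x = 0)
    (hskew : ∀ x y, cross x y = - cross y x)
    (horth : ∀ x y, B (cross x y) x = 0)
    (hcomp : ∀ x y, B (cross x y) (cross x y) = B x x * B y y - (B x y) ^ 2) (x v : V) :
    cross x (cross x v) = B x v • x - B x x • v := by
  rw [← sub_eq_zero]
  refine hnd _ fun w => ?_
  have h := cross_skewAdjoint hskew horth x (cross x v) w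
  have hp := cross_form_polarized hsymm hcomp x v w
  rw [hsymm (cross x w)] at h
  simp only [map_sub, map_smul, LinearMap.sub_apply, LinearMap.smul_apply, smul_eq_mul]
  linear_combination h - hp

lemma cross_comp_self (hsymm : ∀ x y, B x y = B y x)
    (hnd : ∀ x, (∀ y, B x y = 0) → x = 0)
    (hskew : ∀ x y, cross x y = - cross y x)
    (horth : ∀ x y, B (cross x y) x = 0)
    (hcomp : ∀ x y, B (cross x y) (cross x y) = B x x * B y y - (B x y) ^ 2) (x : V) :
    cross x ∘ₗ cross x = (B x).smulRight x - B x x • LinearMap.id := by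
  ext v
  simp [cross_cross_self hsymm hnd hskew horth hcomp]

lemma trace_cross_comp_self [FiniteDimensional ℝ V] (hsymm : ∀ x y, B x y = B y x)
    (hnd : ∀ x, (∀ y, B x y = 0) → x = 0)
    (hskew : ∀ x y, cross x y = - cross y x)
    (horth : ∀ x y, B (cross x y) x = 0)
    (hcomp : ∀ x y, B (cross x y) (cross x y) = B x x * B y y - (B x y) ^ 2) (x : V) :
    LinearMap.trace ℝ V (cross x ∘ₗ cross x) = (1 - Module.finrank ℝ V) * B x x := by
  rw [cross_comp_self hsymm hnd hskew horth hcomp, map_sub, map_smul, LinearMap.trace_id,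
    LinearMap.trace_smulRight, smul_eq_mul]
  ring

end CrossProduct

/-- In dimension 7, the bilinear form is recovered from the cross product via the trace
formula `B(x,y) = -(1/6)·tr(v ↦ x × (y × v))`. -/
theorem stmt_10 (V : Type*) [AddCommGroup V] [Module ℝ V] [FiniteDimensional ℝ V]
    (hdim : Module.finrank ℝ V = 7)
    (B : V →ₗ[ℝ] V →ₗ[ℝ] ℝ) (cross : V →ₗ[ℝ] V →ₗ[ℝ] V)
    (hsymm : ∀ x y, B x y = B y x)
    (hnd : ∀ x, (∀ y, B x y = 0) → x = 0)
    (hskew : ∀ x y, cross x y = - cross y x)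
    (horth : ∀ x y, B (cross x y) x = 0)
    (hcomp : ∀ x y, B (cross x y) (cross x y) = B x x * B y y - (B x y) ^ 2) :
    ∀ x y, B x y = -(1 / 6) * LinearMap.trace ℝ V ((cross x) ∘ₗ (cross y)) := by
  intro x y
  have htrace := trace_cross_comp_self hsymm hnd hskew horth hcomp
  have hadd := htrace (x + y)
  have hx := htrace x
  have hy := htrace y
  have hcomm : LinearMap.trace ℝ V (cross y ∘ₗ cross x) =
      LinearMap.trace ℝ V (cross x ∘ₗ cross y) := LinearMap.trace_comp_comm' _ _
  simp only [map_add, LinearMap.add_apply, LinearMap.add_comp, LinearMap.comp_add, hcomm,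
    hsymm y x, hdim] at hadd hx hy
  push_cast at hadd hx hy
  linarith
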